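/- arXiv:1703.10251 — 5 statements merged into one kernel-verified Lean document; each statement's English description precedes it below -/
import Mathlib

section
/- Let L be a distributive lattice with least element ⊥ and let f : L → L satisfy N1 (∀x, x ⊓ f(x) = ⊥) and N2 (∀x y, x ≤ y → f(y) ≤ f(x)). If there exists n ≥ 1 with f^n = id (the n-fold iterate of f equals the identity), then already f² = id; in particular an index of the form (0, n) with n > 2 is not possible for f. -/
/-- An antitone map with an iterate equal to the identity reflects the order (reversing it). -/
lemma le_of_antitone_of_iterate_eq_id {α : Type*} [Preorder α] {f : α → α} (hf : Antitone f)
    {n : ℕ} (hn : 1 ≤ n) (hfn : f^[n] = id) {a b : α} (h : f a ≤ f b) : b ≤ a := by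
  have hid : ∀ x, (f ∘ f)^[n - 1] (f (f x)) = x := fun x ↦ by
    rw [← Function.comp_apply (f := f) (g := f), ← Function.iterate_succ_apply,
      Nat.succ_eq_add_one, Nat.sub_add_cancel hn]
    change (f^[2])^[n] x = x
    rw [← Function.iterate_mul, mul_comm, Function.iterate_mul, hfn, Function.iterate_id, id]
  simpa only [hid] using (hf.comp hf).iterate (n - 1) (hf h)

theorem stmt2 {L : Type*} [DistribLattice L] [OrderBot L] (f : L → L)
    (hN1 : ∀ x : L, x ⊓ f x = ⊥)
    (hN2 : ∀ x y : L, x ≤ y → f y ≤ f x)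
    (n : ℕ) (hn : 1 ≤ n) (hfn : f^[n] = id) :
    f^[2] = id := by
  have hf : Antitone f := fun x y h ↦ hN2 x y h
  have hsurj : Function.Surjective f := fun y ↦
    ⟨f^[n - 1] y, by
      rw [← Function.iterate_succ_apply' f, Nat.succ_eq_add_one, Nat.sub_add_cancel hn, hfn, id]⟩
  have htop : ∀ y, y ≤ f ⊥ := fun y ↦ by
    obtain ⟨z, rfl⟩ := hsurj y
    exact hf bot_le
  have hinf : ∀ a b, f (a ⊓ b) ≤ f a ⊔ f b := fun a b ↦ by
    obtain ⟨c, hc⟩ := hsurj (f a ⊔ f b)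
    rw [← hc]
    exact hf (le_inf
      (le_of_antitone_of_iterate_eq_id hf hn hfn (hc ▸ le_sup_left))
      (le_of_antitone_of_iterate_eq_id hf hn hfn (hc ▸ le_sup_right)))
  have hle : ∀ x, x ≤ f (f x) := fun x ↦ by
    have hx : x ≤ f x ⊔ f (f x) := (htop x).trans (hN1 x ▸ hinf x (f x))
    calc x = x ⊓ (f x ⊔ f (f x)) := (inf_eq_left.mpr hx).symm
      _ = x ⊓ f (f x) := by rw [inf_sup_left, hN1, bot_sup_eq]
      _ ≤ f (f x) := inf_le_right
  funext x
  exact le_antisymm (le_of_antitone_of_iterate_eq_id hf hn hfn (hle (f x))) (hle x)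
end

section
/- There exist a distributive lattice L with least element ⊥ and a map f : L → L satisfying N1 (∀x, x ⊓ f(x) = ⊥), N2 (∀x y, x ≤ y → f(y) ≤ f(x)) and N3 (∀x, x ≤ f(f(x))), for which N9 fails, i.e., it is not the case that for all x, y ∈ L: x ⊓ y = ⊥ ↔ y ≤ f(x). Hence N1, N2 and N3 together do not imply N9. -/
theorem stmt4 :
    ∃ (L : Type) (_ : DistribLattice L) (_ : OrderBot L) (f : L → L),
      (∀ x : L, x ⊓ f x = ⊥) ∧
      (∀ x y : L, x ≤ y → f y ≤ f x) ∧
      (∀ x : L, x ≤ f (f x)) ∧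
      ¬ (∀ x y : L, x ⊓ y = ⊥ ↔ y ≤ f x) := by
  refine ⟨Bool × Bool, inferInstance, inferInstance, fun x => if x = ⊥ then ⊤ else ⊥, ?_⟩
  decide
end

section
/- Let L be a distributive lattice with least element ⊥. Let f : L → L be a regular negation, i.e., f satisfies N1 (∀x, x ⊓ f(x) = ⊥), N2 (∀x y, x ≤ y → f(y) ≤ f(x)) and N3 (∀x, x ≤ f(f(x))), and let i : L → L be an interior operator, i.e., i(x) ≤ x for all x, i is monotone, and i(i(x)) = i(x) for all x. Then the composite g = i ∘ f satisfies g⁴ = g² (the fourth iterate of g equals its second iterate). -/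
theorem stmt6 {L : Type*} [DistribLattice L] [OrderBot L] (f i : L → L)
    (hN1 : ∀ x : L, x ⊓ f x = ⊥)
    (hN2 : ∀ x y : L, x ≤ y → f y ≤ f x)
    (hN3 : ∀ x : L, x ≤ f (f x))
    (hi_sub : ∀ x : L, i x ≤ x)
    (hi_mono : ∀ a b : L, a ≤ b → i a ≤ i b)
    (hi_idem : ∀ x : L, i (i x) = i x) :
    (i ∘ f)^[4] = (i ∘ f)^[2] := by
  have le_sq (x : L) : i x ≤ i (f (i (f (i x)))) := by
    rw [← hi_idem x]
    apply hi_mono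
    rw [hi_idem x]
    exact (hN3 _).trans (hN2 _ _ (hi_sub _))
  funext x
  change i (f (i (f (i (f (i (f x))))))) = i (f (i (f x)))
  exact le_antisymm (hi_mono _ _ (hN2 _ _ (le_sq _))) (le_sq _)
end

section
/- Let (S, R) be an approximation space. For any A, B ⊆ S there exists C ⊆ S such that C^l = A^l ∩ B^l and C^u = A^u ∩ B^u. (This realizability is what makes the meet operation on rough equivalence classes, and hence the concrete enriched pre-rough algebra, well defined.) -/
/-- Lower approximation in an approximation space (S, R). -/
def lap {S : Type*} (R : S → S → Prop) (A : Set S) : Set S :=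
  {x | ∀ y, R x y → y ∈ A}

/-- Upper approximation in an approximation space (S, R). -/
def uap {S : Type*} (R : S → S → Prop) (A : Set S) : Set S :=
  {x | ∃ y, R x y ∧ y ∈ A}

/-- The lower approximation is a union of equivalence classes. -/
theorem mem_lap_congr {S : Type*} {R : S → S → Prop} (hR : Equivalence R) {A : Set S} {x y : S}
    (h : R x y) : x ∈ lap R A ↔ y ∈ lap R A :=
  ⟨fun hx z hz => hx z (hR.trans h hz), fun hy z hz => hy z (hR.trans (hR.symm h) hz)⟩

/-- The upper approximation is a union of equivalence classes. -/
theorem mem_uap_congr {S : Type*} {R : S → S → Prop} (hR : Equivalence R) {A : Set S} {x y : S}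
    (h : R x y) : x ∈ uap R A ↔ y ∈ uap R A :=
  ⟨fun ⟨z, hz, hA⟩ => ⟨z, hR.trans (hR.symm h) hz, hA⟩, fun ⟨z, hz, hA⟩ => ⟨z, hR.trans h hz, hA⟩⟩

theorem stmt10 {S : Type*} (R : S → S → Prop) (hR : Equivalence R)
    (A B : Set S) :
    ∃ C : Set S, lap R C = lap R A ∩ lap R B ∧ uap R C = uap R A ∩ uap R B := by
  -- On a class contained in `A` use `B`; on any other class meeting `B` use `A`.
  refine ⟨(lap R A ∩ B) ∪ ((A ∩ uap R B) \ lap R A), ?_, ?_⟩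
  · ext x
    constructor
    · intro hx
      have hxA : x ∈ lap R A := by
        by_contra hn
        refine hn fun y hy => ?_
        rcases hx y hy with h | h
        · exact h.1 y (hR.refl y)
        · exact h.1.1
      refine ⟨hxA, fun y hy => ?_⟩
      rcases hx y hy with h | h
      · exact h.2
      · exact absurd ((mem_lap_congr hR hy).1 hxA) h.2
    · rintro ⟨hA, hB⟩ y hy
      exact Or.inl ⟨(mem_lap_congr hR hy).1 hA, hB y hy⟩
  · ext x
    constructor
    · rintro ⟨y, hy, ⟨hA, hB⟩ | ⟨⟨hA, hB⟩, -⟩⟩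
      · exact ⟨⟨y, hy, hA y (hR.refl y)⟩, y, hy, hB⟩
      · exact ⟨⟨y, hy, hA⟩, (mem_uap_congr hR hy).2 hB⟩
    · rintro ⟨⟨y, hy, hA⟩, z, hz, hB⟩
      by_cases hx : x ∈ lap R A
      · exact ⟨z, hz, Or.inl ⟨(mem_lap_congr hR hz).1 hx, hB⟩⟩
      · exact ⟨y, hy, Or.inr ⟨⟨hA, (mem_uap_congr hR hy).1 ⟨z, hz, hB⟩⟩,
          fun h => hx ((mem_lap_congr hR hy).2 h)⟩⟩
end

section
/- Let (S, R) be an approximation space. For every B ⊆ S, the union of the rough equivalence class of B equals the upper approximation of B: ⋃ {C ⊆ S : C ≈ B} = B^u. (This identifies the set ⋃_{z ∈ [B]} z used in the mixed-domain aggregation operation ⊕ of the concrete enriched pre-rough algebra.) -/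
/-- Replacing the part of `B` inside the class of `x` by `{x}` gives a set roughly equal to `B`,
provided `x ∉ B` and the class of `x` meets `B`. -/
theorem roughly_equal_insert_diff_class {S : Type*} {R : S → S → Prop} (hR : Equivalence R)
    {B : Set S} {x : S} (hxB : x ∉ B) (hx : x ∈ uap R B) :
    lap R (insert x (B \ {w | R x w})) = lap R B ∧
      uap R (insert x (B \ {w | R x w})) = uap R B := by
  obtain ⟨y, hxy, hyB⟩ := hx
  have hyx : y ≠ x := fun h => hxB (h ▸ hyB)
  constructor
  · ext z
    by_cases hz : R x z
    · refine iff_of_false (fun h => ?_) fun h => hxB (h x (hR.symm hz))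
      rcases h y (hR.trans (hR.symm hz) hxy) with h | h
      exacts [hyx h, h.2 hxy]
    · refine forall₂_congr fun w hzw => ?_
      have hw : ¬ R x w := fun h => hz (hR.trans h (hR.symm hzw))
      have hwx : w ≠ x := fun h => hw (h ▸ hR.refl w)
      simp [hw, hwx]
  · ext z
    by_cases hz : R x z
    · exact iff_of_true ⟨x, hR.symm hz, Set.mem_insert _ _⟩
        ⟨y, hR.trans (hR.symm hz) hxy, hyB⟩
    · refine exists_congr fun w => and_congr_right fun hzw => ?_
      have hw : ¬ R x w := fun h => hz (hR.trans h (hR.symm hzw))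
      have hwx : w ≠ x := fun h => hw (h ▸ hR.refl w)
      simp [hw, hwx]

theorem stmt14 {S : Type*} (R : S → S → Prop) (hR : Equivalence R) (B : Set S) :
    ⋃₀ {C : Set S | lap R C = lap R B ∧ uap R C = uap R B} = uap R B := by
  apply Set.Subset.antisymm
  · rintro x ⟨C, ⟨-, hC⟩, hx⟩
    exact hC ▸ ⟨x, hR.refl x, hx⟩
  · intro x hx
    by_cases hxB : x ∈ B
    · exact ⟨B, ⟨rfl, rfl⟩, hxB⟩
    · exact ⟨_, roughly_equal_insert_diff_class hR hxB hx, Set.mem_insert _ _⟩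
end
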